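/- Let n ≥ 1, let Ω ⊆ ℝⁿ be open, and let u : Ω → ℝ be a smooth solution of the Lagrangian shrinker potential equation ∑_{i=1}^n arctan λ_i(x) = (1/2) x·∇u(x) − u(x) on Ω, where λ_1(x), …, λ_n(x) are the eigenvalues of D²u(x). Define φ(x) = |x|² + |∇u(x)|² (the squared distance of the point X = (x, ∇u(x)) of the gradient graph to the origin in ℝⁿ × ℝⁿ) and g(x) = I + (D²u(x))², a positive definite symmetric matrix. Then for all x ∈ Ω, trace( g(x)⁻¹ · D²φ(x) ) − (1/2) x·∇φ(x) = 2n − φ(x). -/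

import Mathlib

/-- The `i`-th partial derivative of `u : ℝⁿ → ℝ` at `x`. -/
noncomputable def pd {n : ℕ} (u : EuclideanSpace ℝ (Fin n) → ℝ) (i : Fin n)
    (x : EuclideanSpace ℝ (Fin n)) : ℝ :=
  fderiv ℝ u x (EuclideanSpace.single i 1)

/-- The second partial derivative `∂²_{ij} u` at `x`. -/
noncomputable def pd2 {n : ℕ} (u : EuclideanSpace ℝ (Fin n) → ℝ) (i j : Fin n)
    (x : EuclideanSpace ℝ (Fin n)) : ℝ :=
  pd (fun y => pd u j y) i x

/-- The Hessian matrix `D²u(x)`. -/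
noncomputable def hessM {n : ℕ} (u : EuclideanSpace ℝ (Fin n) → ℝ)
    (x : EuclideanSpace ℝ (Fin n)) : Matrix (Fin n) (Fin n) ℝ :=
  Matrix.of fun i j => pd2 u i j x

open Matrix Filter Topology

section MatrixCalculus

variable {ι : Type*} [Fintype ι] [DecidableEq ι]

/-- **Jacobi's formula** for the derivative of a determinant along a curve of matrices. -/
theorem hasDerivAt_det {M : ℝ → Matrix ι ι ℂ} {M' : Matrix ι ι ℂ} {t : ℝ}
    (hM : ∀ i j, HasDerivAt (fun s => M s i j) (M' i j) t) :
    HasDerivAt (fun s => (M s).det) (trace ((M t).adjugate * M')) t := by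
  have h : HasDerivAt (fun s => ∑ σ : Equiv.Perm ι,
      ((Equiv.Perm.sign σ : ℤ) : ℂ) * ∏ i, M s (σ i) i)
      (∑ σ : Equiv.Perm ι, ((Equiv.Perm.sign σ : ℤ) : ℂ) *
        ∑ i, (∏ j ∈ Finset.univ.erase i, M t (σ j) j) • M' (σ i) i) t :=
    HasDerivAt.fun_sum fun σ _ =>
      (HasDerivAt.fun_finsetProd fun i _ => hM (σ i) i).const_mul _
  have htrace : trace ((M t).adjugate * M') = ∑ i, ((M t).updateCol i (M'.col i)).det := by
    refine Finset.sum_congr rfl fun i _ => ?_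
    rw [← cramer_apply, cramer_eq_adjugate_mulVec]
    rfl
  simp only [det_apply']
  convert h using 1
  rw [htrace]
  simp only [det_apply', Finset.mul_sum]
  rw [Finset.sum_comm]
  refine Finset.sum_congr rfl fun σ _ => Finset.sum_congr rfl fun i _ => ?_
  rw [← Finset.mul_prod_erase _ _ (Finset.mem_univ i), smul_eq_mul, mul_comm (∏ j ∈ _, _)]
  congr 2
  · simp
  · refine Finset.prod_congr rfl fun j hj => ?_
    simp [Finset.ne_of_mem_erase hj]

theorem one_add_I_mul_eq_sqrt_mul_exp_arctan (a : ℝ) :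
    (1 + Complex.I * a : ℂ) =
      (√(1 + a ^ 2) : ℝ) * Complex.exp (Complex.I * (Real.arctan a : ℝ)) := by
  have hpos : √(1 + a ^ 2) ≠ 0 := by positivity
  rw [mul_comm Complex.I ((Real.arctan a : ℝ) : ℂ), Complex.exp_mul_I, ← Complex.ofReal_cos,
    ← Complex.ofReal_sin, Real.cos_arctan, Real.sin_arctan]
  have hpos' : ((√(1 + a ^ 2) : ℝ) : ℂ) ≠ 0 := by exact_mod_cast hpos
  push_cast
  field_simp

theorem det_one_add_I_smul_map_ofReal {A : Matrix ι ι ℝ} (hA : A.IsHermitian) :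
    (1 + Complex.I • A.map Complex.ofReal).det =
      ∏ i, (1 + Complex.I * (hA.eigenvalues i : ℝ)) := by
  have h1 : (1 + Complex.I • A.map Complex.ofReal) =
      (-Complex.I) • (scalar ι Complex.I - A.map Complex.ofReal) := by
    ext i j
    by_cases hij : i = j
    · subst hij
      simp [mul_sub]
    · simp [hij]
  have h2 : (A.map Complex.ofReal).charpoly = A.charpoly.map Complex.ofRealHom :=
    charpoly_map A Complex.ofRealHom
  rw [h1, det_smul, ← eval_charpoly, h2, hA.charpoly_eq, Polynomial.map_prod,
    Polynomial.eval_prod, ← Finset.card_univ, ← Finset.prod_const, ← Finset.prod_mul_distrib]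
  refine Finset.prod_congr rfl fun i _ => ?_
  simp [mul_sub]

theorem exists_det_eq_mul_exp_sum_arctan {A : Matrix ι ι ℝ} (hA : A.IsHermitian) :
    ∃ r : ℝ, (1 + Complex.I • A.map Complex.ofReal).det =
      r * Complex.exp (Complex.I * (∑ i, Real.arctan (hA.eigenvalues i) : ℝ)) := by
  refine ⟨∏ i, √(1 + hA.eigenvalues i ^ 2), ?_⟩
  rw [det_one_add_I_smul_map_ofReal hA,
    Finset.prod_congr rfl fun i _ => one_add_I_mul_eq_sqrt_mul_exp_arctan (hA.eigenvalues i),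
    Finset.prod_mul_distrib, ← Complex.exp_sum, ← Finset.mul_sum]
  push_cast
  rfl

theorem isUnit_det_one_add_sq {A : Matrix ι ι ℝ} (hA : A.IsHermitian) :
    IsUnit (1 + A ^ 2).det := by
  have h := (PosDef.one (n := ι) (R := ℝ)).add_posSemidef (posSemidef_conjTranspose_mul_self A)
  rw [hA.eq, ← sq] at h
  exact h.det_pos.ne'.isUnit

theorem one_add_I_smul_mul_inverse {A : Matrix ι ι ℝ} (hA : A.IsHermitian) :
    (1 + Complex.I • A.map Complex.ofReal) *
      ((1 - Complex.I • A.map Complex.ofReal) * (1 + A ^ 2)⁻¹.map Complex.ofReal) = 1 := by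
  have h := congrArg (fun X : Matrix ι ι ℝ => Complex.ofRealHom.mapMatrix X)
    (mul_nonsing_inv _ (isUnit_det_one_add_sq hA))
  simp only [map_mul, map_add, map_one, map_pow] at h
  rw [← mul_assoc]
  refine Eq.trans ?_ h
  congr 1
  have hI : (Complex.I • A.map Complex.ofReal) * (Complex.I • A.map Complex.ofReal) =
      -(A.map Complex.ofReal) ^ 2 := by
    rw [smul_mul_smul_comm, Complex.I_mul_I, neg_one_smul, sq]
  rw [add_mul, one_mul, mul_sub, mul_one, sub_add_sub_cancel, hI, sub_neg_eq_add]
  rfl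

theorem im_trace_inv_mul {A : Matrix ι ι ℝ} (hA : A.IsHermitian) (B : Matrix ι ι ℝ) :
    (trace ((1 + Complex.I • A.map Complex.ofReal)⁻¹ *
      (Complex.I • B.map Complex.ofReal))).im = trace ((1 + A ^ 2)⁻¹ * B) := by
  rw [inv_eq_right_inv (one_add_I_smul_mul_inverse hA)]
  set G := (1 + A ^ 2)⁻¹
  have h1 : (1 - Complex.I • A.map Complex.ofReal) * G.map Complex.ofReal *
      (Complex.I • B.map Complex.ofReal) =
      Complex.I • Complex.ofRealHom.mapMatrix (G * B) +
        Complex.ofRealHom.mapMatrix (A * G * B) := by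
    simp only [map_mul, RingHom.mapMatrix_apply, sub_mul, one_mul,
      mul_smul_comm, smul_mul_assoc, smul_sub, smul_smul, Complex.I_mul_I, neg_one_smul,
      sub_neg_eq_add]
    rfl
  have h2 (X : Matrix ι ι ℝ) :
      trace (Complex.ofRealHom.mapMatrix X) = ((trace X : ℝ) : ℂ) := by
    simp [trace]
  rw [h1, trace_add, trace_smul, h2, h2]
  simp

/-- First variation of `∑ arctan λᵢ` along a curve of symmetric matrices. -/
theorem trace_inv_mul_eq_of_sum_arctan_eigenvalues {A : ℝ → Matrix ι ι ℝ} {B : Matrix ι ι ℝ}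
    {θ : ℝ → ℝ} {θ' t : ℝ} (hAB : ∀ i j, HasDerivAt (fun s => A s i j) (B i j) t)
    (hθ : HasDerivAt θ θ' t)
    (hA : ∀ᶠ s in 𝓝 t, ∃ h : (A s).IsHermitian, ∑ i, Real.arctan (h.eigenvalues i) = θ s) :
    trace ((1 + A t ^ 2)⁻¹ * B) = θ' := by
  obtain ⟨hsymm, hsum⟩ := hA.self_of_nhds
  set M : ℝ → Matrix ι ι ℂ := fun s => 1 + Complex.I • (A s).map Complex.ofReal with hM
  have hdet : HasDerivAt (fun s => (M s).det)
      (trace ((M t).adjugate * (Complex.I • B.map Complex.ofReal))) t := by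
    refine hasDerivAt_det fun i j => ?_
    simpa [hM] using (((hAB i j).ofReal_comp).const_mul Complex.I).const_add
      ((1 : Matrix ι ι ℂ) i j)
  have hunit : IsUnit (M t).det :=
    (isUnit_iff_isUnit_det _).1 (IsUnit.of_mul_eq_one _ (one_add_I_smul_mul_inverse hsymm))
  have hadj : (M t).adjugate = (M t).det • (M t)⁻¹ := by
    rw [inv_def, smul_smul, Ring.mul_inverse_cancel _ hunit, one_smul]
  rw [hadj, smul_mul_assoc, trace_smul, smul_eq_mul] at hdet
  have hexp : HasDerivAt (fun s => Complex.exp (-Complex.I * (θ s : ℂ)))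
      (Complex.exp (-Complex.I * (θ t : ℂ)) * (-Complex.I * (θ' : ℂ))) t :=
    (hθ.ofReal_comp.const_mul (-Complex.I)).cexp
  have hcancel (s : ℝ) :
      Complex.exp (Complex.I * (θ s : ℂ)) * Complex.exp (-Complex.I * (θ s : ℂ)) = 1 := by
    rw [← Complex.exp_add]
    simp
  have hreal : (fun s => Complex.imCLM ((M s).det * Complex.exp (-Complex.I * (θ s : ℂ))))
      =ᶠ[𝓝 t] fun _ => 0 := by
    filter_upwards [hA] with s ⟨hs, hs'⟩
    obtain ⟨r, hr⟩ := exists_det_eq_mul_exp_sum_arctan hs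
    rw [hs'] at hr
    simp only [hM]
    rw [hr, mul_assoc, hcancel, mul_one]
    simp
  have him := (Complex.imCLM.hasFDerivAt.comp_hasDerivAt t (hdet.mul hexp)).unique
    ((hasDerivAt_const t (0 : ℝ)).congr_of_eventuallyEq hreal)
  obtain ⟨r, hr⟩ := exists_det_eq_mul_exp_sum_arctan hsymm
  rw [hsum] at hr
  have hr0 : r ≠ 0 := by
    rintro rfl
    refine hunit.ne_zero ?_
    simp only [hM]
    rw [hr]
    simp
  set T := trace ((M t)⁻¹ * (Complex.I • B.map Complex.ofReal)) with hT
  have hfactor : (M t).det * T * Complex.exp (-Complex.I * (θ t : ℂ)) +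
      (M t).det * (Complex.exp (-Complex.I * (θ t : ℂ)) * (-Complex.I * (θ' : ℂ))) =
      (r : ℂ) * (T - Complex.I * θ') := by
    have hr' : (M t).det = r * Complex.exp (Complex.I * (θ t : ℂ)) := hr
    rw [hr']
    linear_combination (r : ℂ) * (T - Complex.I * θ') * hcancel t
  rw [hfactor] at him
  have him' : r * (T.im - θ') = 0 := by simpa using him
  have := (mul_eq_zero.1 him').resolve_left hr0
  rw [← im_trace_inv_mul hsymm B]
  linarith

end MatrixCalculus

section PartialDerivatives

open scoped ContDiff

variable {n : ℕ} {f g : EuclideanSpace ℝ (Fin n) → ℝ} {x : EuclideanSpace ℝ (Fin n)}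

theorem hasDerivAt_pd (hf : DifferentiableAt ℝ f x) (i : Fin n) :
    HasDerivAt (fun t : ℝ => f (x + t • EuclideanSpace.single i 1)) (pd f i x) 0 :=
  hf.hasFDerivAt.hasLineDerivAt _

theorem pd_eq_of_hasDerivAt (hf : DifferentiableAt ℝ f x) {i : Fin n} {d : ℝ}
    (h : HasDerivAt (fun t : ℝ => f (x + t • EuclideanSpace.single i 1)) d 0) :
    pd f i x = d :=
  (hasDerivAt_pd hf i).unique h

theorem pd_congr (h : f =ᶠ[𝓝 x] g) (i : Fin n) : pd f i x = pd g i x := by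
  rw [pd, pd, h.fderiv_eq]

theorem contDiffAt_pd (hf : ContDiffAt ℝ ∞ f x) (i : Fin n) : ContDiffAt ℝ ∞ (pd f i) x :=
  (hf.fderiv_right (m := ∞) (by simp)).clm_apply contDiffAt_const

theorem ContDiffAt.differentiableAt_of_infty (hf : ContDiffAt ℝ ∞ f x) :
    DifferentiableAt ℝ f x :=
  hf.differentiableAt (by simp)

theorem pd2_comm (hf : ContDiffAt ℝ ∞ f x) (i j : Fin n) : pd2 f i j x = pd2 f j i x := by
  have hd : DifferentiableAt ℝ (fderiv ℝ f) x :=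
    (hf.fderiv_right (m := ∞) (by simp)).differentiableAt (by simp)
  have key (i j : Fin n) : pd2 f i j x =
      fderiv ℝ (fderiv ℝ f) x (EuclideanSpace.single i 1) (EuclideanSpace.single j 1) := by
    unfold pd2 pd
    rw [fderiv_clm_apply hd (differentiableAt_const _)]
    simp
  rw [key, key]
  exact (hf.isSymmSndFDerivAt (by simpa using WithTop.coe_le_coe.2 (le_top : (2 : ℕ∞) ≤ ⊤))) _ _

theorem hasDerivAt_coord (i j : Fin n) :
    HasDerivAt (fun t : ℝ => (x + t • EuclideanSpace.single j (1 : ℝ)) i)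
      (if i = j then 1 else 0) 0 := by
  have h := ((hasDerivAt_id (0 : ℝ)).mul_const (if i = j then (1 : ℝ) else 0)).const_add (x i)
  simpa [Pi.single_apply] using h

theorem pd_half_euler_sub (hf : ContDiffAt ℝ ∞ f x) (k : Fin n) :
    pd (fun y => (1 / 2) * (∑ i, y i * pd f i y) - f y) k x =
      (1 / 2) * (∑ i, x i * pd2 f k i x) - (1 / 2) * pd f k x := by
  have hp (i : Fin n) := (contDiffAt_pd hf i).differentiableAt_of_infty
  have hd := hf.differentiableAt_of_infty
  refine pd_eq_of_hasDerivAt (by fun_prop) ?_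
  refine HasDerivAt.congr_deriv (((HasDerivAt.fun_sum fun i (_ : i ∈ Finset.univ) =>
    (hasDerivAt_coord (x := x) i k).mul (hasDerivAt_pd (hp i) k)).const_mul (1 / 2 : ℝ)).sub
    (hasDerivAt_pd hd k)) ?_
  simp [Finset.sum_add_distrib, pd2]
  ring

theorem pd_sq_add_sq_grad (hf : ContDiffAt ℝ ∞ f x) (j : Fin n) :
    pd (fun y => (∑ i, (y i) ^ 2) + ∑ i, (pd f i y) ^ 2) j x =
      2 * x j + 2 * ∑ k, pd f k x * pd2 f j k x := by
  have hp (i : Fin n) := (contDiffAt_pd hf i).differentiableAt_of_infty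
  refine pd_eq_of_hasDerivAt (by fun_prop) ?_
  refine HasDerivAt.congr_deriv ((HasDerivAt.fun_sum fun i (_ : i ∈ Finset.univ) =>
    (hasDerivAt_coord (x := x) i j).pow 2).add (HasDerivAt.fun_sum fun i (_ : i ∈ Finset.univ) =>
    (hasDerivAt_pd (hp i) j).pow 2)) ?_
  simp [Finset.mul_sum, pd2, mul_assoc]

theorem pd_two_mul_coord_add (hf : ContDiffAt ℝ ∞ f x) (i j : Fin n) :
    pd (fun y => 2 * y j + 2 * ∑ k, pd f k y * pd2 f j k y) i x =
      2 * (if j = i then 1 else 0) + 2 * ∑ k, (pd2 f i k x * pd2 f j k x +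
        pd f k x * pd (fun y => pd2 f j k y) i x) := by
  have hp (i : Fin n) := (contDiffAt_pd hf i).differentiableAt_of_infty
  have hpp (k : Fin n) : DifferentiableAt ℝ (fun y => pd2 f j k y) x :=
    (contDiffAt_pd (contDiffAt_pd hf k) j).differentiableAt_of_infty
  refine pd_eq_of_hasDerivAt (by fun_prop) ?_
  refine HasDerivAt.congr_deriv (((hasDerivAt_coord (x := x) j i).const_mul (2 : ℝ)).add
    ((HasDerivAt.fun_sum fun k (_ : k ∈ Finset.univ) =>
    (hasDerivAt_pd (hp k) i).mul (hasDerivAt_pd (hpp k) i)).const_mul (2 : ℝ))) ?_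
  simp [pd2]

/-- Third partial derivatives of a smooth function do not depend on the order. -/
theorem pd_pd2_rotate (hf : ∀ᶠ y in 𝓝 x, ContDiffAt ℝ ∞ f y) (i j k : Fin n) :
    pd (fun y => pd2 f j k y) i x = pd (fun y => pd2 f i j y) k x := by
  have h1 : (fun y => pd2 f j k y) =ᶠ[𝓝 x] fun y => pd2 f k j y :=
    hf.mono fun y hy => pd2_comm hy j k
  rw [pd_congr h1]
  exact pd2_comm (contDiffAt_pd hf.self_of_nhds j) i k

end PartialDerivatives

/-- Drift-Laplacian identity for the squared distance to the origin on a graphical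
Lagrangian shrinker: if `u` solves the potential equation and
`φ(x) = |x|² + |∇u(x)|²`, then `trace(g⁻¹ D²φ) − (1/2) x·∇φ = 2n − φ` on `Ω`,
where `g = I + (D²u)²` is the induced metric. -/
theorem lagrangian_shrinker_distance_squared_identity
    (n : ℕ) (hn : 1 ≤ n) (Ω : Set (EuclideanSpace ℝ (Fin n))) (hΩ : IsOpen Ω)
    (u : EuclideanSpace ℝ (Fin n) → ℝ) (hu : ContDiffOn ℝ (⊤ : ℕ∞) u Ω)
    (heq : ∀ x ∈ Ω, ∀ h : (hessM u x).IsHermitian,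
      ∑ i, Real.arctan (h.eigenvalues i)
        = (1 / 2) * (∑ i, x i * pd u i x) - u x)
    (φ : EuclideanSpace ℝ (Fin n) → ℝ)
    (hφ : ∀ y, φ y = (∑ i, (y i) ^ 2) + ∑ i, (pd u i y) ^ 2) :
    ∀ x ∈ Ω,
      Matrix.trace ((1 + hessM u x ^ 2)⁻¹ * hessM φ x)
          - (1 / 2) * ∑ i, x i * pd φ i x
        = 2 * n - φ x := by
  intro x hx
  have hsmooth (y) (hy : y ∈ Ω) : ContDiffAt ℝ (⊤ : ℕ∞) u y :=
    hu.contDiffAt (hΩ.mem_nhds hy)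
  have hux := hsmooth x hx
  have hΩx : ∀ᶠ y in 𝓝 x, y ∈ Ω := hΩ.mem_nhds hx
  have hsmooth' : ∀ᶠ y in 𝓝 x, ContDiffAt ℝ (⊤ : ℕ∞) u y := hΩx.mono hsmooth
  have hherm (y) (hy : y ∈ Ω) : (hessM u y).IsHermitian :=
    Matrix.IsHermitian.ext fun i j => by simpa [hessM] using pd2_comm (hsmooth y hy) j i
  have hvar (k : Fin n) : trace ((1 + hessM u x ^ 2)⁻¹ *
      Matrix.of fun i j => pd (fun y => pd2 u i j y) k x) =
      (1 / 2) * (∑ i, x i * pd2 u k i x) - (1 / 2) * pd u k x := by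
    rw [← pd_half_euler_sub hux k]
    have hline : Tendsto (fun t : ℝ => x + t • EuclideanSpace.single k (1 : ℝ)) (𝓝 0) (𝓝 x) := by
      refine Continuous.tendsto' (by fun_prop) _ _ (by simp)
    have hp (i : Fin n) := (contDiffAt_pd hux i).differentiableAt_of_infty
    have hd := hux.differentiableAt_of_infty
    have := trace_inv_mul_eq_of_sum_arctan_eigenvalues
      (A := fun t : ℝ => hessM u (x + t • EuclideanSpace.single k 1))
      (B := Matrix.of fun i j => pd (fun y => pd2 u i j y) k x) (t := 0)
      (fun i j => hasDerivAt_pd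
        (contDiffAt_pd (contDiffAt_pd hux j) i).differentiableAt_of_infty k)
      (hasDerivAt_pd (f := fun y => (1 / 2) * (∑ i, y i * pd u i y) - u y) (by fun_prop) k)
      ((hline.eventually hΩx).mono fun t ht => ⟨hherm _ ht, heq _ ht _⟩)
    simpa using this
  have hφ' : φ = fun y => (∑ i, (y i) ^ 2) + ∑ i, (pd u i y) ^ 2 := funext hφ
  have hgrad (y) (hy : ContDiffAt ℝ (⊤ : ℕ∞) u y) (j : Fin n) :
      pd φ j y = 2 * y j + 2 * ∑ k, pd u k y * pd2 u j k y := by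
    rw [hφ', pd_sq_add_sq_grad hy]
  have hhess : hessM φ x = (2 : ℝ) • (1 + hessM u x ^ 2) +
      (2 : ℝ) • ∑ k, pd u k x • Matrix.of fun i j => pd (fun y => pd2 u i j y) k x := by
    ext i j
    have h1 : hessM φ x i j = pd (fun y => 2 * y j + 2 * ∑ k, pd u k y * pd2 u j k y) i x :=
      pd_congr (hsmooth'.mono fun y hy => hgrad y hy j) i
    rw [h1, pd_two_mul_coord_add hux]
    simp only [Matrix.add_apply, Matrix.smul_apply, Matrix.sum_apply, Matrix.one_apply, sq,
      Matrix.mul_apply, Matrix.of_apply, smul_eq_mul, hessM, Finset.sum_add_distrib,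
      pd_pd2_rotate hsmooth' i j, pd2_comm hux j, eq_comm (a := j)]
    ring
  rw [hhess, mul_add, trace_add, mul_smul_comm, mul_smul_comm, trace_smul, trace_smul,
    nonsing_inv_mul _ (isUnit_det_one_add_sq (hherm x hx)), trace_one, Finset.mul_sum, trace_sum]
  simp only [mul_smul_comm, trace_smul, hvar, hgrad x hux, hφ, smul_eq_mul, Fintype.card_fin]
  have hswap : ∑ i, x i * ∑ k, pd u k x * pd2 u i k x =
      ∑ k, pd u k x * ∑ i, x i * pd2 u k i x := by
    simp only [Finset.mul_sum]
    rw [Finset.sum_comm]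
    refine Finset.sum_congr rfl fun k _ => Finset.sum_congr rfl fun i _ => ?_
    rw [pd2_comm hux i k]
    ring
  have hE : ∑ i, x i * (2 * x i + 2 * ∑ k, pd u k x * pd2 u i k x) =
      2 * ∑ i, x i ^ 2 + 2 * ∑ k, pd u k x * ∑ i, x i * pd2 u k i x := by
    rw [← hswap, Finset.mul_sum, Finset.mul_sum, ← Finset.sum_add_distrib]
    exact Finset.sum_congr rfl fun i _ => by ring
  have hT : ∑ k, pd u k x * ((1 / 2) * (∑ i, x i * pd2 u k i x) - (1 / 2) * pd u k x) =
      (1 / 2) * ∑ k, pd u k x * (∑ i, x i * pd2 u k i x) - (1 / 2) * ∑ k, pd u k x ^ 2 := by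
    rw [Finset.mul_sum, Finset.mul_sum, ← Finset.sum_sub_distrib]
    exact Finset.sum_congr rfl fun i _ => by ring
  rw [hE, hT]
  ring
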